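/- Let D be a regular 𝓓-class of IG(E), let r ∈ D and e ∈ E, and suppose ē·r ∈ D. Then ē·r 𝓛 r. Moreover, for every s ∈ D with s 𝓡 r, we also have ē·s ∈ D, ē·s 𝓛 s, and ē·s 𝓡 ē·r. -/

import Mathlib

section Green

variable {T : Type*} [Semigroup T]

/-- Green's relation 𝓡. -/
def GreenR (a b : T) : Prop := a = b ∨ ∃ x y : T, a * x = b ∧ b * y = a

/-- Green's relation 𝓛. -/
def GreenL (a b : T) : Prop := a = b ∨ ∃ x y : T, x * a = b ∧ y * b = a

/-- Green's relation 𝓓 = 𝓡 ∘ 𝓛. -/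
def GreenD (a b : T) : Prop := ∃ c : T, GreenR a c ∧ GreenL c b

/-- An element is regular if `a = a * b * a` for some `b`. -/
def IsRegularElem (a : T) : Prop := ∃ b : T, a * b * a = a

/-- The principal two-sided ideal `T¹ a T¹`. -/
def principalIdeal (a : T) : Set T :=
  {x | x = a ∨ (∃ u, u * a = x) ∨ (∃ v, a * v = x) ∨ ∃ u v, u * a * v = x}

/-- Green's relation 𝓙. -/
def GreenJ (a b : T) : Prop := principalIdeal a = principalIdeal b

/-- The 𝓙-preorder. -/
def JleRel (a b : T) : Prop := principalIdeal a ⊆ principalIdeal b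

/-- Strict 𝓙-order. -/
def JltRel (a b : T) : Prop := JleRel a b ∧ ¬ JleRel b a

/-- `u` is a (two-sided) identity element. -/
def IsIdentityElem (u : T) : Prop := ∀ x : T, u * x = x ∧ x * u = x

/-- The relation 𝓡̃. -/
def RTilde (a b : T) : Prop := ∀ ε : T, ε * ε = ε → (ε * a = a ↔ ε * b = b)

/-- The relation 𝓛̃. -/
def LTilde (a b : T) : Prop := ∀ ε : T, ε * ε = ε → (a * ε = a ↔ b * ε = b)

/-- `blockProd p i k = p i * p (i+1) * ⋯ * p (i+k)`. -/
def blockProd (p : ℕ → T) (i : ℕ) : ℕ → T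
  | 0 => p i
  | k + 1 => blockProd p i k * p (i + (k + 1))

/-- Multiply `x` by optional (possibly empty) words on both sides. -/
def withCtx (u : Option T) (x : T) (v : Option T) : T :=
  match u, v with
  | none, none => x
  | some u', none => u' * x
  | none, some v' => x * v'
  | some u', some v' => u' * x * v'

/-- Multiply by an optional word on the left. -/
def leftCtx (u : Option T) (x : T) : T := match u with | none => x | some u' => u' * x

/-- Multiply by an optional word on the right. -/
def rightCtx (x : T) (v : Option T) : T := match v with | none => x | some v' => x * v'

end Green

section IGdef

/-- The set of idempotents of `S`. -/
abbrev IdemE (S : Type*) [Semigroup S] : Type _ := {x : S // x * x = x}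

variable {S : Type*} [Semigroup S]

/-- `e, f` form a basic pair if `{e,f} ∩ {ef,fe} ≠ ∅`. -/
def BasicPair (e f : IdemE S) : Prop :=
  (e : S) * f = e ∨ (e : S) * f = f ∨ (f : S) * e = e ∨ (f : S) * e = f

/-- The defining relations of IG(E): `ef = g` whenever `e, f` is a basic pair with
product `g` in `S`. -/
def igRelBase (u v : FreeSemigroup (IdemE S)) : Prop :=
  ∃ e f g : IdemE S, BasicPair e f ∧ (g : S) = (e : S) * (f : S) ∧
    u = FreeSemigroup.of e * FreeSemigroup.of f ∧ v = FreeSemigroup.of g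

/-- The congruence on the free semigroup `E⁺` generated by the defining relations. -/
def igCon (S : Type*) [Semigroup S] : Con (FreeSemigroup (IdemE S)) :=
  conGen (fun u v => igRelBase u v)

/-- The free idempotent generated semigroup IG(E). -/
abbrev IG (S : Type*) [Semigroup S] := (igCon S).Quotient

/-- `w̄`, the image of a word `w ∈ E⁺` in IG(E). -/
def igBar (w : FreeSemigroup (IdemE S)) : IG S := (w : (igCon S).Quotient)

/-- The list of letters of a word. -/
def wordList (w : FreeSemigroup (IdemE S)) : List (IdemE S) := w.head :: w.tail

/-- The length of a word. -/
def wlen (w : FreeSemigroup (IdemE S)) : ℕ := (wordList w).length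

/-- Length of an optional word. -/
def olen (u : Option (FreeSemigroup (IdemE S))) : ℕ :=
  match u with | none => 0 | some u' => wlen u'

/-- `p 1, …, p m` is an r-factorisation of `w`: each factor represents a regular
element of IG(E). -/
def IsRFact (w : FreeSemigroup (IdemE S)) (m : ℕ) (p : ℕ → FreeSemigroup (IdemE S)) : Prop :=
  1 ≤ m ∧ blockProd p 1 (m - 1) = w ∧ ∀ i, 1 ≤ i → i ≤ m → IsRegularElem (igBar (p i))

/-- A minimal r-factorisation: no product of two or more consecutive factors is regular. -/
def IsMinRFact (w : FreeSemigroup (IdemE S)) (m : ℕ) (p : ℕ → FreeSemigroup (IdemE S)) : Prop :=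
  IsRFact w m p ∧
    ∀ i j, 1 ≤ i → i < j → j ≤ m → ¬ IsRegularElem (igBar (blockProd p i (j - i)))

/-- The relation ≈ on m-tuples of words. -/
def TupleApprox (m : ℕ) (p q : ℕ → FreeSemigroup (IdemE S)) : Prop :=
  (∃ i, 1 ≤ i ∧ i ≤ m ∧ igBar (p i) = igBar (q i) ∧
    ∀ j, 1 ≤ j → j ≤ m → j ≠ i → p j = q j) ∨
  (∃ i, ∃ e : IdemE S, 1 ≤ i ∧ i < m ∧
    igBar (p i) = igBar (q i * FreeSemigroup.of e) ∧
    igBar (q (i + 1)) = igBar (FreeSemigroup.of e * p (i + 1)) ∧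
    ∀ j, 1 ≤ j → j ≤ m → j ≠ i → j ≠ i + 1 → p j = q j) ∨
  (∃ i, ∃ e : IdemE S, 1 ≤ i ∧ i < m ∧
    igBar (q i) = igBar (p i * FreeSemigroup.of e) ∧
    igBar (p (i + 1)) = igBar (FreeSemigroup.of e * q (i + 1)) ∧
    ∀ j, 1 ≤ j → j ≤ m → j ≠ i → j ≠ i + 1 → p j = q j)

/-- The relation ∼: the transitive closure of ≈. -/
def TupleSim (m : ℕ) (p q : ℕ → FreeSemigroup (IdemE S)) : Prop :=
  Relation.TransGen (TupleApprox m) p q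

/-- One application of a defining relation of IG(E) inside a word. -/
def RewriteStep (w w' : FreeSemigroup (IdemE S)) : Prop :=
  ∃ (u v : Option (FreeSemigroup (IdemE S))) (x y : FreeSemigroup (IdemE S)),
    (igRelBase x y ∨ igRelBase y x) ∧ w = withCtx u x v ∧ w' = withCtx u y v

/-- `e` is a seed of `w` at (1-based) position `k`. -/
def SeedAt (w : FreeSemigroup (IdemE S)) (e : IdemE S) (k : ℕ) : Prop :=
  ∃ u v : Option (FreeSemigroup (IdemE S)),
    w = withCtx u (FreeSemigroup.of e) v ∧ k = olen u + 1 ∧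
    GreenL (igBar (leftCtx u (FreeSemigroup.of e))) (igBar (FreeSemigroup.of e)) ∧
    GreenR (igBar (FreeSemigroup.of e)) (igBar (rightCtx (FreeSemigroup.of e) v))

/-- The coordinate (position within `w` of the first letter) of the `i`-th factor. -/
def wcoord (p : ℕ → FreeSemigroup (IdemE S)) (i : ℕ) : ℕ :=
  1 + ∑ j ∈ Finset.Ico 1 i, wlen (p j)

end IGdef


section FullFactor

variable {M : Type*} [Monoid M]

/-- In the factorisation `a * y * b`, the factor `y` satisfies `a * y 𝓛 y 𝓡 y * b`. -/
def IsFullFactor (a y b : M) : Prop := (∃ s, s * (a * y) = y) ∧ ∃ t, y * b * t = y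

theorem IsFullFactor.extend {a y b c d : M} (h : IsFullFactor (a * c) y (d * b)) :
    IsFullFactor a (c * y * d) b := by
  obtain ⟨⟨s, hs⟩, t, ht⟩ := h
  refine ⟨⟨c * s, ?_⟩, t * d, ?_⟩
  · calc c * s * (a * (c * y * d)) = c * (s * (a * c * y)) * d := by simp only [mul_assoc]
      _ = c * y * d := by rw [hs]
  · calc c * y * d * b * (t * d) = c * (y * (d * b) * t) * d := by simp only [mul_assoc]
      _ = c * y * d := by rw [ht]

theorem eq_one_of_mul_eq_one_of_idem {f s : M} (hf : f * f = f) (h : s * f = 1) : f = 1 := by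
  calc f = s * f * f := by rw [h, one_mul]
    _ = 1 := by rw [mul_assoc, hf, h]

theorem eq_one_of_idem_mul_eq_one {f s : M} (hf : f * f = f) (h : f * s = 1) : f = 1 := by
  calc f = f * (f * s) := by rw [h, mul_one]
    _ = 1 := by rw [← mul_assoc, hf, h]

variable {α : Type*} (m : α → M)

/-- The value in `M` of a word over `α`. -/
def wordValue (w : List α) : M := (w.map m).prod

@[simp] theorem wordValue_nil : wordValue m [] = 1 := rfl

@[simp] theorem wordValue_cons (e : α) (w : List α) :
    wordValue m (e :: w) = m e * wordValue m w := by simp [wordValue]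

@[simp] theorem wordValue_append (u v : List α) :
    wordValue m (u ++ v) = wordValue m u * wordValue m v := by simp [wordValue]

/-- No block of the factorised word `L`, read after the prefix value `a`, is a full factor. -/
def NoFullBlock : M → List (List α) → Prop
  | _, [] => True
  | a, B :: L => ¬ IsFullFactor a (wordValue m B) (wordValue m L.flatten) ∧
      NoFullBlock (a * wordValue m B) L

variable {m}

theorem NoFullBlock.drop_head {f : α} (hf : m f * m f = m f) {v : List α} :
    ∀ {L : List (List α)} {a : M}, NoFullBlock m a L → L.flatten = f :: v →
      ∃ L' : List (List α), L'.length = L.length ∧ L'.flatten = v ∧ NoFullBlock m (a * m f) L'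
  | [], _, _, h => by simp at h
  | [] :: L, a, ⟨hB, hL⟩, h => by
    have hLv : L.flatten = f :: v := by simpa using h
    have hL' : NoFullBlock m a L := by simpa using hL
    obtain ⟨L', hlen, hfl, hN⟩ := hL'.drop_head hf hLv
    refine ⟨[] :: L', by simp [hlen], by simp [hfl], ?_, by simpa using hN⟩
    rw [hLv] at hB
    rw [hfl]
    rintro ⟨⟨s, hs⟩, t, ht⟩
    simp only [wordValue_nil, mul_one, one_mul] at hs ht
    have hf1 : m f = 1 := eq_one_of_mul_eq_one_of_idem hf (by rw [mul_assoc]; exact hs)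
    exact hB ⟨⟨s, by simpa [hf1] using hs⟩, t, by simpa [hf1] using ht⟩
  | (c :: B) :: L, a, ⟨hB, hL⟩, h => by
    have hv : c = f ∧ B ++ L.flatten = v := by simpa using h
    obtain ⟨rfl, hv⟩ := hv
    refine ⟨B :: L, rfl, by simpa using hv, fun hF => hB ?_, by simpa [mul_assoc] using hL⟩
    have := IsFullFactor.extend (a := a) (c := m c) (y := wordValue m B) (d := 1)
      (b := wordValue m L.flatten) (by simpa using hF)
    simpa using this

theorem NoFullBlock.replace_head {e f g : α} (he : m e * m e = m e) (hg : m e * m f = m g)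
    (hfg : m f * m g = m f) {v : List α} :
    ∀ {L : List (List α)} {a : M}, NoFullBlock m (a * m e) L → L.flatten = f :: v →
      ∃ L' : List (List α), L'.length = L.length ∧ L'.flatten = g :: v ∧ NoFullBlock m a L'
  | [], _, _, h => by simp at h
  | [] :: L, a, ⟨hB, hL⟩, h => by
    have hLv : L.flatten = f :: v := by simpa using h
    have hL' : NoFullBlock m (a * m e) L := by simpa using hL
    obtain ⟨L', hlen, hfl, hN⟩ := hL'.replace_head he hg hfg hLv
    refine ⟨[] :: L', by simp [hlen], by simp [hfl], ?_, by simpa using hN⟩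
    rw [hLv] at hB
    rw [hfl]
    rintro ⟨⟨s, hs⟩, t, ht⟩
    simp only [wordValue_nil, wordValue_cons, mul_one, one_mul, ← hg] at hs ht
    have he1 : m e = 1 := eq_one_of_idem_mul_eq_one he (by simpa only [mul_assoc] using ht)
    exact hB ⟨⟨s, by simpa [he1] using hs⟩, t, by simpa [he1] using ht⟩
  | (c :: B) :: L, a, ⟨hB, hL⟩, h => by
    have hv : c = f ∧ B ++ L.flatten = v := by simpa using h
    obtain ⟨rfl, hv⟩ := hv
    refine ⟨(g :: B) :: L, rfl, by simpa using hv, ?_, by simpa [← hg, mul_assoc] using hL⟩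
    rintro ⟨⟨s, hs⟩, t, ht⟩
    refine hB ⟨⟨m c * s, ?_⟩, t, ?_⟩ <;> simp only [wordValue_cons] at hs ht ⊢
    · calc m c * s * (a * m e * (m c * wordValue m B))
          = m c * (s * (a * (m e * m c * wordValue m B))) := by simp only [mul_assoc]
        _ = m c * m g * wordValue m B := by rw [hg, hs, mul_assoc]
        _ = m c * wordValue m B := by rw [hfg]
    · calc m c * wordValue m B * wordValue m L.flatten * t
          = m c * (m g * wordValue m B * wordValue m L.flatten * t) := by
            conv_lhs => rw [← hfg]
            simp only [mul_assoc]
        _ = m c * m g * wordValue m B := by rw [ht, mul_assoc]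
        _ = m c * wordValue m B := by rw [hfg]

theorem NoFullBlock.contract {e f g : α} (he : m e * m e = m e) (hf : m f * m f = m f)
    (hg : m e * m f = m g) (hb : m g * m e = m e ∨ m f * m g = m f) {v : List α} :
    ∀ {L : List (List α)} {a : M} {u : List α}, NoFullBlock m a L →
      L.flatten = u ++ e :: f :: v →
      ∃ L' : List (List α), L'.length = L.length ∧ L'.flatten = u ++ g :: v ∧ NoFullBlock m a L'
  | [], _, _, _, h => by simp at h
  | B :: L, a, u, ⟨hB, hL⟩, h => by
    have recurse : ∀ u', u = B ++ u' → L.flatten = u' ++ e :: f :: v →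
        ∃ L' : List (List α), L'.length = (B :: L).length ∧ L'.flatten = u ++ g :: v ∧
          NoFullBlock m a L' := by
      rintro u' rfl hLu
      obtain ⟨L', hlen, hfl, hN⟩ := hL.contract he hf hg hb hLu
      refine ⟨B :: L', by simp [hlen], by simp [hfl], ?_, hN⟩
      rw [hLu] at hB
      rw [hfl]
      simpa [← hg, mul_assoc] using hB
    rw [List.flatten_cons, List.append_eq_append_iff] at h
    rcases h with ⟨u', rfl, hLu⟩ | ⟨c, rfl, hc⟩
    · exact recurse u' rfl hLu
    rcases c with _ | ⟨e', _ | ⟨f', c⟩⟩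
    · exact recurse [] (by simp) (by simpa using hc.symm)
    · obtain ⟨rfl, hLf⟩ : e = e' ∧ f :: v = L.flatten := by simpa using hc
      rcases hb with hge | hfg
      · obtain ⟨L', hlen, hfl, hN⟩ := hL.drop_head hf hLf.symm
        refine ⟨(u ++ [g]) :: L', by simp [hlen], by simp [hfl], ?_,
          by simpa [← hg, mul_assoc] using hN⟩
        rw [hfl]
        rw [← hLf] at hB
        rintro ⟨⟨s, hs⟩, t, ht⟩
        simp only [wordValue_append, wordValue_cons, wordValue_nil, mul_one] at hB hs ht
        refine hB ⟨⟨s, ?_⟩, t * m e, ?_⟩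
        · calc s * (a * (wordValue m u * m e))
              = s * (a * (wordValue m u * m g)) * m e := by
                conv_lhs => rw [← hge]
                simp only [mul_assoc]
            _ = wordValue m u * m e := by rw [hs, mul_assoc, hge]
        · calc wordValue m u * m e * (m f * wordValue m v) * (t * m e)
              = wordValue m u * (m e * m f) * wordValue m v * t * m e := by simp only [mul_assoc]
            _ = wordValue m u * m e := by rw [hg, ht, mul_assoc, hge]
      · have hL' : NoFullBlock m (a * wordValue m u * m e) L := by simpa [mul_assoc] using hL
        obtain ⟨L', hlen, hfl, hN⟩ := hL'.replace_head he hg hfg hLf.symm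
        refine ⟨u :: L', by simp [hlen], by simp [hfl], fun hF => hB ?_, hN⟩
        rw [hfl] at hF
        rw [← hLf]
        have := IsFullFactor.extend (a := a) (c := 1) (y := wordValue m u) (d := m e)
          (b := m f * wordValue m v) (by simpa [← hg, mul_assoc] using hF)
        simpa using this
    · obtain ⟨rfl, rfl, rfl⟩ : e = e' ∧ f = f' ∧ v = c ++ L.flatten := by simpa using hc
      refine ⟨(u ++ g :: c) :: L, rfl, by simp, ?_, ?_⟩
      · simpa [← hg, mul_assoc] using hB
      · simpa [← hg, mul_assoc] using hL

theorem NoFullBlock.expand {e f g : α} (hg : m e * m f = m g) {v : List α} :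
    ∀ {L : List (List α)} {a : M} {u : List α}, NoFullBlock m a L →
      L.flatten = u ++ g :: v →
      ∃ L' : List (List α), L'.length = L.length ∧ L'.flatten = u ++ e :: f :: v ∧
        NoFullBlock m a L'
  | [], _, _, _, h => by simp at h
  | B :: L, a, u, ⟨hB, hL⟩, h => by
    have recurse : ∀ u', u = B ++ u' → L.flatten = u' ++ g :: v →
        ∃ L' : List (List α), L'.length = (B :: L).length ∧ L'.flatten = u ++ e :: f :: v ∧
          NoFullBlock m a L' := by
      rintro u' rfl hLu
      obtain ⟨L', hlen, hfl, hN⟩ := hL.expand hg hLu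
      refine ⟨B :: L', by simp [hlen], by simp [hfl], ?_, hN⟩
      rw [hLu] at hB
      rw [hfl]
      simpa [← hg, mul_assoc] using hB
    rw [List.flatten_cons, List.append_eq_append_iff] at h
    rcases h with ⟨u', rfl, hLu⟩ | ⟨c, rfl, hc⟩
    · exact recurse u' rfl hLu
    rcases c with _ | ⟨g', c⟩
    · exact recurse [] (by simp) (by simpa using hc.symm)
    · obtain ⟨rfl, rfl⟩ : g = g' ∧ v = c ++ L.flatten := by simpa using hc
      refine ⟨(u ++ e :: f :: c) :: L, rfl, by simp, ?_, ?_⟩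
      · simpa [← hg, mul_assoc] using hB
      · simpa [← hg, mul_assoc] using hL

theorem NoFullBlock.le_length {w : List α} (hw : w ≠ [])
    (hx : wordValue m w * wordValue m w = wordValue m w) :
    ∀ {L : List (List α)} {a : M} {r : List α} {n : ℕ}, NoFullBlock m a L →
      L.flatten = r ++ (List.replicate n w).flatten →
      a * wordValue m r * wordValue m w = wordValue m w → n ≤ L.length
  | _, _, _, 0, _, _, _ => Nat.zero_le _
  | [], _, _, n + 1, _, h, _ => by simp [List.replicate_succ, hw] at h
  | B :: L, a, r, n + 1, ⟨hB, hL⟩, h, ha => by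
    have habs : ∀ k, wordValue m w * wordValue m (List.replicate k w).flatten = wordValue m w := by
      intro k
      induction k with
      | zero => simp
      | succ k ih => rw [List.replicate_succ, List.flatten_cons, wordValue_append, ← mul_assoc,
          hx, ih]
    rw [List.flatten_cons, List.replicate_succ, List.flatten_cons, ← List.append_assoc,
      List.append_eq_append_iff] at h
    rcases h with ⟨r', hr, hLr⟩ | ⟨c, rfl, hc⟩
    · refine Nat.succ_le_succ (hL.le_length hw hx hLr ?_)
      have := congrArg (wordValue m) hr
      simp only [wordValue_append] at this
      rw [mul_assoc a, ← this, ← mul_assoc, ha, hx]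
    · refine absurd ?_ hB
      have key : IsFullFactor (a * wordValue m r) (wordValue m w)
          (wordValue m c * wordValue m L.flatten) := by
        refine ⟨⟨1, by rw [one_mul, ha]⟩, 1, ?_⟩
        rw [mul_one, ← wordValue_append, ← hc, habs]
      simpa [mul_assoc] using key.extend

theorem flatten_map_singleton (w : List α) : (w.map fun e => [e]).flatten = w := by
  induction w with
  | nil => rfl
  | cons e w ih => simp [ih]

theorem NoFullBlock.singletons : ∀ {w : List α} {a : M},
    (∀ u e v, w = u ++ e :: v → ¬ IsFullFactor (a * wordValue m u) (m e) (wordValue m v)) →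
      NoFullBlock m a (w.map fun e => [e])
  | [], _, _ => trivial
  | c :: w, a, h => by
    refine ⟨?_, NoFullBlock.singletons fun u e v hw => ?_⟩
    · rw [flatten_map_singleton]
      simpa using h [] c w rfl
    · simpa [mul_assoc] using h (c :: u) e v (by simp [hw])

end FullFactor

section IGIdempotents

variable {S : Type*} [Semigroup S]

theorem wordList_mul (w w' : FreeSemigroup (IdemE S)) :
    wordList (w * w') = wordList w ++ wordList w' := rfl

theorem igBar_mul (w w' : FreeSemigroup (IdemE S)) : igBar (w * w') = igBar w * igBar w' := rfl

/-- The image of an idempotent of `S` in `IG(E)` with an identity adjoined. -/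
def igGen (e : IdemE S) : WithOne (IG S) := (igBar (FreeSemigroup.of e) : IG S)

theorem igGen_mul {e f g : IdemE S} (h : BasicPair e f) (hg : (g : S) = e * f) :
    igGen e * igGen f = igGen g := by
  rw [igGen, igGen, igGen, ← WithOne.coe_mul, WithOne.coe_inj, ← igBar_mul]
  exact (Con.eq _).2 (ConGen.Rel.of _ _ ⟨e, f, g, h, hg, rfl, rfl⟩)

theorem igGen_mul_self (e : IdemE S) : igGen e * igGen e = igGen e :=
  igGen_mul (Or.inl e.2) e.2.symm

theorem igGen_mul_of_basicPair {e f g : IdemE S} (h : BasicPair e f) (hg : (g : S) = e * f) :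
    igGen g * igGen e = igGen e ∨ igGen f * igGen g = igGen f := by
  have he := e.2
  have hf := f.2
  rcases h with h | h | h | h
  · left
    have hge : (g : S) * e = e := by rw [hg, h, he]
    exact igGen_mul (Or.inr (Or.inl hge)) hge.symm
  · right
    have hfg : (f : S) * g = f := by rw [hg, h, hf]
    exact igGen_mul (Or.inl hfg) hfg.symm
  · left
    have hge : (g : S) * e = e := by rw [hg, mul_assoc, h, he]
    exact igGen_mul (Or.inr (Or.inl hge)) hge.symm
  · right
    have hfg : (f : S) * g = f := by rw [hg, ← mul_assoc, h, hf]
    exact igGen_mul (Or.inl hfg) hfg.symm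

theorem wordValue_wordList (w : FreeSemigroup (IdemE S)) :
    wordValue igGen (wordList w) = (igBar w : WithOne (IG S)) := by
  induction w with
  | ih1 e => exact mul_one _
  | ih2 e w _ ih =>
    rw [wordList_mul, wordValue_append, ih, igBar_mul, WithOne.coe_mul]
    congr 1

/-- Having a factorisation into `k` non-full blocks is invariant under the congruence
defining `IG(E)`. -/
theorem exists_noFullBlock_iff_of_igCon {w w' : FreeSemigroup (IdemE S)} (h : igCon S w w')
    (k : ℕ) (u v : List (IdemE S)) :
    (∃ L : List (List (IdemE S)), L.length = k ∧ L.flatten = u ++ wordList w ++ v ∧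
      NoFullBlock igGen 1 L) ↔
    (∃ L : List (List (IdemE S)), L.length = k ∧ L.flatten = u ++ wordList w' ++ v ∧
      NoFullBlock igGen 1 L) := by
  change ConGen.Rel _ w w' at h
  induction h generalizing u v with
  | of w w' h =>
    obtain ⟨e, f, g, hef, hg, rfl, rfl⟩ := h
    have hprod := igGen_mul hef hg
    constructor
    · rintro ⟨L, rfl, hL, hN⟩
      obtain ⟨L', hlen, hfl, hN'⟩ := hN.contract (v := v) (u := u) (igGen_mul_self e)
        (igGen_mul_self f) hprod (igGen_mul_of_basicPair hef hg) (by simp [hL, wordList])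
      exact ⟨L', hlen, by simp [hfl, wordList], hN'⟩
    · rintro ⟨L, rfl, hL, hN⟩
      obtain ⟨L', hlen, hfl, hN'⟩ := hN.expand (v := v) (u := u) hprod (by simp [hL, wordList])
      exact ⟨L', hlen, by simp [hfl, wordList], hN'⟩
  | refl => exact Iff.rfl
  | symm _ ih => exact (ih u v).symm
  | trans _ _ ih₁ ih₂ => exact (ih₁ u v).trans (ih₂ u v)
  | @mul a b c d _ _ ih₁ ih₂ =>
    have h₁ := ih₁ u (wordList c ++ v)
    have h₂ := ih₂ (u ++ wordList b) v
    simp only [wordList_mul, List.append_assoc] at h₁ h₂ ⊢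
    exact h₁.trans h₂

theorem exists_word_replicate (w : FreeSemigroup (IdemE S)) (hw : igBar w * igBar w = igBar w)
    (n : ℕ) : ∃ w' : FreeSemigroup (IdemE S), igCon S w w' ∧
      wordList w' = (List.replicate (n + 1) (wordList w)).flatten := by
  induction n with
  | zero => exact ⟨w, (igCon S).refl w, by simp⟩
  | succ n ih =>
    obtain ⟨w', hww', hl⟩ := ih
    refine ⟨w * w', ?_, by rw [wordList_mul, hl, List.replicate_succ (n := n + 1),
      List.flatten_cons]⟩
    have hsq : igCon S w (w * w) := (Con.eq _).1 hw.symm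
    exact (igCon S).trans hsq ((igCon S).mul ((igCon S).refl w) hww')

/-- Every word representing an idempotent of `IG(E)` has a letter that is a full factor. -/
theorem exists_full_letter (w : FreeSemigroup (IdemE S)) (hw : igBar w * igBar w = igBar w) :
    ∃ u e v, wordList w = u ++ e :: v ∧
      IsFullFactor (wordValue igGen u) (igGen e) (wordValue igGen v) := by
  by_contra! hcon
  have hN : NoFullBlock igGen 1 ((wordList w).map fun e => [e]) :=
    NoFullBlock.singletons fun u e v h => by simpa using hcon u e v h
  obtain ⟨w', hww', hl⟩ := exists_word_replicate w hw (wordList w).length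
  obtain ⟨L, hlen, hfl, hL⟩ :=
    (exists_noFullBlock_iff_of_igCon hww' (wordList w).length [] []).1
      ⟨_, by simp, by simp [flatten_map_singleton], hN⟩
  have hle := hL.le_length (w := wordList w) (r := []) (n := (wordList w).length + 1)
    (by simp [wordList])
    (by rw [wordValue_wordList, ← WithOne.coe_mul, hw]) (by simpa [hl] using hfl) (by simp)
  omega

/-- The canonical homomorphism from `IG(E)` to `S`. -/
def igHom (S : Type*) [Semigroup S] : IG S →ₙ* S where
  toFun x := Con.liftOn x (FreeSemigroup.lift ((↑) : IdemE S → S)) fun a b h => by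
    have hle : igCon S ≤ Con.ker (FreeSemigroup.lift ((↑) : IdemE S → S)) := by
      refine Con.conGen_le.2 ?_
      rintro _ _ ⟨e, f, g, -, hg, rfl, rfl⟩
      rw [Con.ker_rel, map_mul, FreeSemigroup.lift_of, FreeSemigroup.lift_of,
        FreeSemigroup.lift_of, hg]
    exact Con.ker_rel _ |>.1 (hle h)
  map_mul' x y := by
    induction x, y using Con.induction_on₂ with
    | H a b => exact map_mul _ a b

theorem igHom_igBar_of (e : IdemE S) : igHom S (igBar (FreeSemigroup.of e)) = e := rfl

/-- Right translation by a generator, when it stays in the `𝓡`-class of an idempotent `f ∈ E`,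
takes the `𝓛`-class of `f` to the `𝓛`-class of some `g ∈ E`. -/
theorem exists_igGen_of_mul_igGen {f e : IdemE S} {z : WithOne (IG S)}
    (h : igGen f * igGen e * z = igGen f) :
    ∃ y g : IdemE S, igGen f * igGen y = igGen f ∧ igGen y * igGen f = igGen y ∧
      igGen y * igGen e = igGen g := by
  have hx : ∃ x : IG S, (x : WithOne (IG S)) = igGen e * z * igGen f := by
    cases z with
    | one => exact ⟨igBar (FreeSemigroup.of e) * igBar (FreeSemigroup.of f), by simp [igGen]⟩
    | coe z => exact ⟨igBar (FreeSemigroup.of e) * z * igBar (FreeSemigroup.of f), by simp [igGen]⟩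
  obtain ⟨x, hx⟩ := hx
  have hex : igBar (FreeSemigroup.of e) * x = x := by
    rw [← WithOne.coe_inj, WithOne.coe_mul, hx]
    change igGen e * _ = _
    rw [← mul_assoc, ← mul_assoc, igGen_mul_self]
  have hxf : x * igBar (FreeSemigroup.of f) = x := by
    rw [← WithOne.coe_inj, WithOne.coe_mul, hx]
    change _ * igGen f = _
    rw [mul_assoc, igGen_mul_self]
  have hfx : igBar (FreeSemigroup.of f) * x = igBar (FreeSemigroup.of f) := by
    rw [← WithOne.coe_inj, WithOne.coe_mul, hx]
    change igGen f * _ = igGen f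
    rw [← mul_assoc, ← mul_assoc, h, igGen_mul_self]
  have hey := congrArg (igHom S) hex
  have hyf := congrArg (igHom S) hxf
  have hfy := congrArg (igHom S) hfx
  simp only [map_mul, igHom_igBar_of] at hey hyf hfy
  generalize igHom S x = y at hey hyf hfy
  have hyy : y * y = y := by
    calc y * y = y * f * y := by rw [hyf]
      _ = y := by rw [mul_assoc, hfy, hyf]
  have hge : y * e * (y * e) = y * e := by
    rw [mul_assoc, ← mul_assoc (e : S), hey, ← mul_assoc, hyy]
  exact ⟨⟨y, hyy⟩, ⟨y * e, hge⟩, igGen_mul (Or.inl hfy) hfy.symm, igGen_mul (Or.inl hyf) hyf.symm,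
    igGen_mul (Or.inr (Or.inr (Or.inl hey))) rfl⟩

/-- An element of the `𝓡`-class of some `f ∈ E` is `𝓛`-related to some `g ∈ E`. -/
theorem exists_igGen_mul_wordValue : ∀ (v : List (IdemE S)) {f : IdemE S} {z : WithOne (IG S)},
    igGen f * wordValue igGen v * z = igGen f →
      ∃ (g : IdemE S) (p q : WithOne (IG S)), igGen f * wordValue igGen v = p * igGen g ∧
        igGen g = q * (igGen f * wordValue igGen v)
  | [], f, _, _ => ⟨f, 1, 1, by simp, by simp⟩
  | e :: v, f, z, h => by
    rw [wordValue_cons] at h ⊢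
    obtain ⟨y, g, hfy, hyf, hye⟩ := exists_igGen_of_mul_igGen (f := f) (e := e)
      (z := wordValue igGen v * z) (by simpa only [mul_assoc] using h)
    have hg : igGen g * wordValue igGen v * (z * igGen e) = igGen g := by
      calc igGen g * wordValue igGen v * (z * igGen e)
          = igGen y * (igGen f * (igGen e * wordValue igGen v) * z) * igGen e := by
            rw [← hye]
            conv_lhs => rw [← hyf]
            simp only [mul_assoc]
        _ = igGen g := by rw [h, hyf, hye]
    obtain ⟨k, p, q, hp, hq⟩ := exists_igGen_mul_wordValue v hg
    refine ⟨k, igGen f * p, q * igGen y, ?_, ?_⟩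
    · rw [mul_assoc, ← hp, ← hye]
      conv_lhs => rw [← hfy]
      simp only [mul_assoc]
    · rw [hq, ← hye]
      conv_lhs => rw [← hyf]
      simp only [mul_assoc]

/-- Every idempotent of `IG(E)` is `𝓛`-related to the image of an idempotent of `S`. -/
theorem exists_igGen_of_idem {x : IG S} (hx : x * x = x) :
    ∃ (g : IdemE S) (p q : WithOne (IG S)), (x : WithOne (IG S)) = p * igGen g ∧
      igGen g = q * x := by
  induction x using Con.induction_on with
  | H w =>
    obtain ⟨u, e, v, hw, ⟨s, hs⟩, t, ht⟩ := exists_full_letter w hx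
    obtain ⟨g, p, q, hp, hq⟩ := exists_igGen_mul_wordValue v ht
    have hval : ((w : IG S) : WithOne (IG S)) =
        wordValue igGen u * (igGen e * wordValue igGen v) := by
      rw [← wordValue_cons, ← wordValue_append, ← hw]
      exact (wordValue_wordList w).symm
    refine ⟨g, wordValue igGen u * p, q * s, by rw [hval, hp, mul_assoc], ?_⟩
    rw [hval, hq]
    conv_lhs => rw [← hs]
    simp only [mul_assoc]

/-- Every regular element of `IG(E)` is `𝓛`-related to the image of an idempotent of `S`. -/
theorem exists_igGen_of_regular {x : IG S} (hx : IsRegularElem x) :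
    ∃ (g : IdemE S) (p q : WithOne (IG S)), (x : WithOne (IG S)) = p * igGen g ∧
      igGen g = q * x := by
  obtain ⟨b, hb⟩ := hx
  have hbx : b * x * (b * x) = b * x := by rw [mul_assoc, ← mul_assoc x, hb]
  obtain ⟨g, p, q, hp, hq⟩ := exists_igGen_of_idem hbx
  refine ⟨g, x * p, q * b, ?_, ?_⟩
  · rw [mul_assoc, ← hp, ← WithOne.coe_mul, ← mul_assoc, hb]
  · rw [hq, WithOne.coe_mul, mul_assoc]

end IGIdempotents

section GreenWithOne

variable {T : Type*} [Semigroup T]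

theorem greenR_iff_withOne {a b : T} :
    GreenR a b ↔ ∃ x y : WithOne T, (a : WithOne T) * x = b ∧ (b : WithOne T) * y = a := by
  constructor
  · rintro (rfl | ⟨x, y, hx, hy⟩)
    · exact ⟨1, 1, mul_one _, mul_one _⟩
    · exact ⟨x, y, by rw [← WithOne.coe_mul, hx], by rw [← WithOne.coe_mul, hy]⟩
  · rintro ⟨x, y, hx, hy⟩
    cases x with
    | one => exact Or.inl (WithOne.coe_inj.1 (by simpa using hx))
    | coe x =>
      cases y with
      | one => exact Or.inl (WithOne.coe_inj.1 (by simpa using hy.symm))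
      | coe y => exact Or.inr ⟨x, y, WithOne.coe_inj.1 hx, WithOne.coe_inj.1 hy⟩

theorem greenL_iff_withOne {a b : T} :
    GreenL a b ↔ ∃ x y : WithOne T, x * (a : WithOne T) = b ∧ y * (b : WithOne T) = a := by
  constructor
  · rintro (rfl | ⟨x, y, hx, hy⟩)
    · exact ⟨1, 1, one_mul _, one_mul _⟩
    · exact ⟨x, y, by rw [← WithOne.coe_mul, hx], by rw [← WithOne.coe_mul, hy]⟩
  · rintro ⟨x, y, hx, hy⟩
    cases x with
    | one => exact Or.inl (WithOne.coe_inj.1 (by simpa using hx))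
    | coe x =>
      cases y with
      | one => exact Or.inl (WithOne.coe_inj.1 (by simpa using hy.symm))
      | coe y => exact Or.inr ⟨x, y, WithOne.coe_inj.1 hx, WithOne.coe_inj.1 hy⟩

theorem IsRegularElem.of_greenR {a b : T} (ha : IsRegularElem a) (h : GreenR a b) :
    IsRegularElem b := by
  obtain ⟨z, hz⟩ := ha
  rcases h with rfl | ⟨x, y, rfl, hy⟩
  · exact ⟨z, hz⟩
  · exact ⟨y * z, by rw [← mul_assoc (a * x), hy, ← mul_assoc, hz]⟩

theorem IsRegularElem.of_greenL {a b : T} (ha : IsRegularElem a) (h : GreenL a b) :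
    IsRegularElem b := by
  obtain ⟨z, hz⟩ := ha
  rcases h with rfl | ⟨x, y, rfl, hy⟩
  · exact ⟨z, hz⟩
  · exact ⟨z * y, by rw [mul_assoc, mul_assoc z, hy, mul_assoc, ← mul_assoc a, hz]⟩

theorem GreenR.symm {a b : T} (h : GreenR a b) : GreenR b a :=
  h.elim (fun h => Or.inl h.symm) fun ⟨x, y, hx, hy⟩ => Or.inr ⟨y, x, hy, hx⟩

theorem GreenL.symm {a b : T} (h : GreenL a b) : GreenL b a :=
  h.elim (fun h => Or.inl h.symm) fun ⟨x, y, hx, hy⟩ => Or.inr ⟨y, x, hy, hx⟩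

theorem IsRegularElem.of_greenD_idem {a ε : T} (hε : ε * ε = ε) (h : GreenD a ε) :
    IsRegularElem a := by
  obtain ⟨c, hac, hcε⟩ := h
  have hreg : IsRegularElem ε := ⟨ε, by rw [hε, hε]⟩
  exact (hreg.of_greenL hcε.symm).of_greenR hac.symm

end GreenWithOne

/-- Stability: left multiplication by `A` of a regular `r ∈ IG(E)` that stays in the `𝓡`-class
of `r` also stays in the `𝓛`-class of `r`, when `E` is finite. -/
theorem exists_mul_mul_eq_of_regular {S : Type*} [Semigroup S] [Finite (IdemE S)] {r : IG S}
    (hr : IsRegularElem r) {A δ β : WithOne (IG S)} (hA : A * r = r * δ)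
    (hβ : A * r * β = r) : ∃ k : WithOne (IG S), k * (A * r) = r := by
  have hpow : ∀ n, A ^ n * r = r * δ ^ n := by
    intro n
    induction n with
    | zero => simp
    | succ n ih => rw [pow_succ, mul_assoc, hA, ← mul_assoc, ih, mul_assoc, ← pow_succ]
  have hpowβ : ∀ n, A ^ n * r * β ^ n = r := by
    intro n
    induction n with
    | zero => simp
    | succ n ih =>
      calc A ^ (n + 1) * r * β ^ (n + 1) = A * (A ^ n * r * β ^ n) * β := by
            rw [pow_succ', pow_succ]
            simp only [mul_assoc]
        _ = r := by rw [ih, hβ]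
  have hL : ∀ n, ∃ (g : IdemE S) (p q : WithOne (IG S)), A ^ n * r = p * igGen g ∧
      igGen g = q * (A ^ n * r) := by
    intro n
    have hc : ∃ c : IG S, (c : WithOne (IG S)) = A ^ n * r := by
      generalize A ^ n = B
      cases B with
      | one => exact ⟨r, by simp⟩
      | coe B => exact ⟨B * r, by simp⟩
    obtain ⟨c, hc⟩ := hc
    rw [← hc]
    refine exists_igGen_of_regular (hr.of_greenR (greenR_iff_withOne.2 ⟨δ ^ n, β ^ n, ?_, ?_⟩))
    · rw [hc, hpow]
    · rw [hc, hpowβ]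
  choose g p q hp hq using hL
  have step : ∀ i j, i < j → g i = g j → ∃ k : WithOne (IG S), k * (A * r) = r := by
    intro i j hij hg
    obtain ⟨d, rfl⟩ := Nat.exists_eq_add_of_lt hij
    refine ⟨p i * q (i + d + 1) * A ^ d, ?_⟩
    calc p i * q (i + d + 1) * A ^ d * (A * r)
        = p i * q (i + d + 1) * A ^ (d + 1) * (A ^ i * r * β ^ i) := by
          rw [hpowβ, pow_succ]
          simp only [mul_assoc]
      _ = p i * (q (i + d + 1) * (A ^ (i + d + 1) * r)) * β ^ i := by
          rw [show i + d + 1 = d + 1 + i by omega, pow_add A (d + 1) i]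
          simp only [mul_assoc]
      _ = r := by rw [← hq, ← hg, ← hp, hpowβ]
  obtain ⟨i, j, hij, hg⟩ := Finite.exists_ne_map_eq_of_infinite g
  rcases lt_or_gt_of_ne hij with h | h
  · exact step i j h hg
  · exact step j i h hg.symm

theorem stmt8 {S : Type*} [Semigroup S] [Finite (IdemE S)]
    (r : IG S) (hreg : ∃ ε : IG S, ε * ε = ε ∧ GreenD r ε)
    (e : IdemE S) (hre : GreenD r (igBar (FreeSemigroup.of e) * r)) :
    GreenL (igBar (FreeSemigroup.of e) * r) r ∧
    ∀ s : IG S, GreenD r s → GreenR s r →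
      GreenD r (igBar (FreeSemigroup.of e) * s) ∧
      GreenL (igBar (FreeSemigroup.of e) * s) s ∧
      GreenR (igBar (FreeSemigroup.of e) * s) (igBar (FreeSemigroup.of e) * r) := by
  obtain ⟨ε, hε, hrε⟩ := hreg
  have hr : IsRegularElem r := IsRegularElem.of_greenD_idem hε hrε
  have hL : GreenL (igBar (FreeSemigroup.of e) * r) r := by
    obtain ⟨c, hrc, hcx⟩ := hre
    obtain ⟨δ, β, hδ, hβ⟩ := greenR_iff_withOne.1 hrc
    obtain ⟨-, a, -, ha⟩ := greenL_iff_withOne.1 hcx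
    have hAr : a * igGen e * r = c := by
      rw [← ha, WithOne.coe_mul, mul_assoc, igGen]
    obtain ⟨k, hk⟩ := exists_mul_mul_eq_of_regular hr (hAr.trans hδ.symm) (by rw [hAr, hβ])
    refine greenL_iff_withOne.2 ⟨k * a, igGen e, ?_, rfl⟩
    simpa only [WithOne.coe_mul, mul_assoc, igGen] using hk
  refine ⟨hL, fun s _ hsr => ?_⟩
  obtain ⟨k, -, hk, -⟩ := greenL_iff_withOne.1 hL
  obtain ⟨b, a, hb, ha⟩ := greenR_iff_withOne.1 hsr
  have hLs : GreenL (igBar (FreeSemigroup.of e) * s) s := by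
    refine greenL_iff_withOne.2 ⟨k, igGen e, ?_, rfl⟩
    rw [WithOne.coe_mul, ← ha, ← mul_assoc _ (r : WithOne (IG S)), ← mul_assoc k,
      ← WithOne.coe_mul, hk]
  refine ⟨⟨s, hsr.symm, hLs.symm⟩, hLs, greenR_iff_withOne.2 ⟨b, a, ?_, ?_⟩⟩
  · rw [WithOne.coe_mul, mul_assoc, hb, WithOne.coe_mul]
  · rw [WithOne.coe_mul, mul_assoc, ha, WithOne.coe_mul]
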